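/- arXiv:1009.3751 — 2 statements merged into one kernel-verified Lean document; each statement's English description precedes it below -/
import Mathlib

section
/- Let q be a PMF on a finite alphabet of m symbols with all entries strictly positive, and for each positive integer k let q^{(k)} denote the k-fold product PMF on the alphabet of m^k blocks, q^{(k)}(i_1,…,i_k) = q_{i_1}⋯q_{i_k}. Then for every k there exists a dyadic PMF p^{(k)} on the block alphabet with D(p^{(k)}‖q^{(k)}) ≤ log 2; in particular, the normalized Kullback-Leibler distance (1/k)·min over dyadic PMFs p of D(p‖q^{(k)}) tends to 0 as k → ∞. -/
/-- A probability mass function on a finite alphabet: nonnegative entries summing to 1. -/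
def IsPMF {α : Type*} [Fintype α] (p : α → ℝ) : Prop :=
  (∀ i, 0 ≤ p i) ∧ ∑ i, p i = 1

/-- A PMF is dyadic if every entry is 0 or of the form 2^(-ℓ) for a natural number ℓ. -/
def IsDyadic {α : Type*} [Fintype α] (p : α → ℝ) : Prop :=
  ∀ i, p i = 0 ∨ ∃ ℓ : ℕ, p i = (2 : ℝ) ^ (-(ℓ : ℤ))

/-- Kullback-Leibler distance D(p‖x) = Σ_i p_i log(p_i / x_i) (natural log),
with the convention 0·log 0 = 0. -/
noncomputable def KL {α : Type*} [Fintype α] (p x : α → ℝ) : ℝ :=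
  ∑ i, p i * Real.log (p i / x i)

open Finset in
/-- A finite family of powers of `1/2` with total mass at least one has a subfamily of total mass
exactly one. -/
theorem exists_subset_sum_half_pow_eq_one {ι : Type*} [DecidableEq ι] (l : ι → ℕ)
    (s : Finset ι) (hs : 1 ≤ ∑ i ∈ s, (1 / 2 : ℝ) ^ l i) :
    ∃ t ⊆ s, ∑ i ∈ t, (1 / 2 : ℝ) ^ l i = 1 := by
  induction s using Finset.strongInduction with
  | H s ih =>
    rcases hs.eq_or_lt with h | h
    · exact ⟨s, Subset.rfl, h.symm⟩
    have hne : s.Nonempty := by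
      by_contra! hempty
      norm_num [hempty] at h
    obtain ⟨j, hj, hmax⟩ := s.exists_max_image l hne
    have hterm (i : ι) (hi : i ∈ s) :
        (1 / 2 : ℝ) ^ l i = ((2 ^ (l j - l i) : ℕ) : ℝ) * (1 / 2 : ℝ) ^ l j := by
      obtain ⟨d, hd⟩ := Nat.exists_eq_add_of_le (hmax i hi)
      rw [hd, Nat.add_sub_cancel_left, pow_add, Nat.cast_pow, mul_left_comm, Nat.cast_ofNat,
        ← mul_pow]
      norm_num
    have hone : (1 : ℝ) = ((2 ^ l j : ℕ) : ℝ) * (1 / 2 : ℝ) ^ l j := by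
      rw [Nat.cast_pow, Nat.cast_ofNat, ← mul_pow]
      norm_num
    have hsum : ∑ i ∈ s, (1 / 2 : ℝ) ^ l i =
        ((∑ i ∈ s, 2 ^ (l j - l i) : ℕ) : ℝ) * (1 / 2 : ℝ) ^ l j := by
      rw [Nat.cast_sum, Finset.sum_mul]
      exact Finset.sum_congr rfl hterm
    have hc : (0 : ℝ) < (1 / 2 : ℝ) ^ l j := by positivity
    have hlt : 2 ^ l j + 1 ≤ ∑ i ∈ s, 2 ^ (l j - l i) := by
      have hscaled := hone.symm.trans_lt (h.trans_eq hsum)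
      exact_mod_cast lt_of_mul_lt_mul_right hscaled hc.le
    have hge : 1 + (1 / 2 : ℝ) ^ l j ≤ ∑ i ∈ s, (1 / 2 : ℝ) ^ l i := by
      have hcast : (((2 ^ l j : ℕ) : ℝ) + 1) ≤ ((∑ i ∈ s, 2 ^ (l j - l i) : ℕ) : ℝ) := by
        exact_mod_cast hlt
      rw [hsum]
      have := mul_le_mul_of_nonneg_right hcast hc.le
      linarith
    have herase := Finset.add_sum_erase s (fun i => (1 / 2 : ℝ) ^ l i) hj
    obtain ⟨t, ht, hsumt⟩ := ih (s.erase j) (Finset.erase_ssubset hj) (by linarith)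
    exact ⟨t, ht.trans (Finset.erase_subset _ _), hsumt⟩

/-- Every strictly positive PMF is dominated, up to a factor two, by a dyadic PMF. -/
theorem exists_isDyadic_le_two_mul {α : Type*} [Fintype α] {x : α → ℝ}
    (hx : IsPMF x) (hpos : ∀ i, 0 < x i) :
    ∃ p : α → ℝ, IsPMF p ∧ IsDyadic p ∧ ∀ i, p i ≤ 2 * x i := by
  classical
  have hle (i : α) : x i ≤ 1 :=
    hx.2 ▸ Finset.single_le_sum (fun j _ => hx.1 j) (Finset.mem_univ i)
  choose l hl using fun i => exists_nat_pow_near_of_lt_one (hpos i) (hle i)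
    (by norm_num : (0 : ℝ) < 1 / 2) (by norm_num)
  obtain ⟨t, -, ht⟩ := exists_subset_sum_half_pow_eq_one l Finset.univ
    (hx.2.ge.trans (Finset.sum_le_sum fun i _ => (hl i).2))
  refine ⟨fun i => if i ∈ t then (1 / 2 : ℝ) ^ l i else 0, ⟨fun i => ?_, ?_⟩, fun i => ?_,
    fun i => ?_⟩
  · dsimp only
    split_ifs <;> positivity
  · simpa using ht
  · by_cases h : i ∈ t
    · exact Or.inr ⟨l i, by simp [h]⟩
    · exact Or.inl (by simp [h])
  · have h1 := (hl i).1
    have h2 := hpos i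
    rw [pow_succ] at h1
    dsimp only
    split_ifs <;> linarith

theorem KL_le_log_of_le_mul {α : Type*} [Fintype α] {p x : α → ℝ} {c : ℝ}
    (hp : IsPMF p) (hpos : ∀ i, 0 < x i) (hle : ∀ i, p i ≤ c * x i) :
    KL p x ≤ Real.log c := by
  calc KL p x ≤ ∑ i, p i * Real.log c := by
        refine Finset.sum_le_sum fun i _ => ?_
        rcases (hp.1 i).eq_or_lt with h | h
        · simp [← h]
        · exact mul_le_mul_of_nonneg_left
            (Real.log_le_log (div_pos h (hpos i)) ((div_le_iff₀ (hpos i)).2 (hle i))) h.le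
    _ = Real.log c := by rw [← Finset.sum_mul, hp.2, one_mul]

/-- Gibbs' inequality. -/
theorem KL_nonneg {α : Type*} [Fintype α] {p x : α → ℝ}
    (hp : IsPMF p) (hx : IsPMF x) (hpos : ∀ i, 0 < x i) : 0 ≤ KL p x := by
  calc 0 = ∑ i, (p i - x i) := by rw [Finset.sum_sub_distrib, hp.2, hx.2, sub_self]
    _ ≤ KL p x := by
        refine Finset.sum_le_sum fun i _ => ?_
        rcases (hp.1 i).eq_or_lt with h | h
        · simp [← h, (hpos i).le]
        · have := mul_le_mul_of_nonneg_left
            (Real.one_sub_inv_le_log_of_pos (div_pos h (hpos i))) h.le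
          rwa [inv_div, mul_sub, mul_one, mul_div_cancel₀ _ h.ne'] at this

theorem IsPMF.prod_pow {α : Type*} [Fintype α] {q : α → ℝ} (hq : IsPMF q) (k : ℕ) :
    IsPMF (fun b : Fin k → α => ∏ t, q (b t)) :=
  ⟨fun b => Finset.prod_nonneg fun t _ => hq.1 (b t), by
    rw [← Fintype.sum_pow, hq.2, one_pow]⟩

/-- For a strictly positive PMF `q` on `m` symbols and its `k`-fold product PMF
`q^(k)` on blocks, for every positive `k` there is a dyadic PMF `p^(k)` on blocks
with `D(p^(k)‖q^(k)) ≤ log 2`; in particular the normalized minimal KL distance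
`(1/k)·inf_{p dyadic} D(p‖q^(k))` tends to 0 as `k → ∞`. -/
theorem ghc_asymptotically_optimal (m : ℕ) (q : Fin m → ℝ)
    (hq : IsPMF q) (hpos : ∀ i, 0 < q i) :
    (∀ k : ℕ, 0 < k → ∃ p : (Fin k → Fin m) → ℝ, IsPMF p ∧ IsDyadic p ∧
        KL p (fun b => ∏ t, q (b t)) ≤ Real.log 2) ∧
      Filter.Tendsto
        (fun k : ℕ => (1 / (k : ℝ)) *
          sInf {d : ℝ | ∃ p : (Fin k → Fin m) → ℝ, IsPMF p ∧ IsDyadic p ∧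
            d = KL p (fun b => ∏ t, q (b t))})
        Filter.atTop (nhds 0) := by
  have hpos' (k : ℕ) (b : Fin k → Fin m) : 0 < ∏ t, q (b t) :=
    Finset.prod_pos fun t _ => hpos (b t)
  have hex (k : ℕ) : ∃ p : (Fin k → Fin m) → ℝ, IsPMF p ∧ IsDyadic p ∧
      KL p (fun b => ∏ t, q (b t)) ≤ Real.log 2 := by
    obtain ⟨p, hp, hd, hle⟩ := exists_isDyadic_le_two_mul (hq.prod_pow k) (hpos' k)
    exact ⟨p, hp, hd, KL_le_log_of_le_mul hp (hpos' k) hle⟩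
  refine ⟨fun k _ => hex k, ?_⟩
  have hlim : Filter.Tendsto (fun k : ℕ => (1 / (k : ℝ)) * Real.log 2) Filter.atTop (nhds 0) := by
    simpa using tendsto_one_div_atTop_nhds_zero_nat.mul_const (Real.log 2)
  have hlower (k : ℕ) : ∀ d ∈ {d : ℝ | ∃ p : (Fin k → Fin m) → ℝ, IsPMF p ∧ IsDyadic p ∧
      d = KL p (fun b => ∏ t, q (b t))}, 0 ≤ d := by
    rintro _ ⟨p, hp, -, rfl⟩
    exact KL_nonneg hp (hq.prod_pow k) (hpos' k)
  refine squeeze_zero (fun k => mul_nonneg (by positivity) (Real.sInf_nonneg (hlower k)))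
    (fun k => mul_le_mul_of_nonneg_left ?_ (by positivity)) hlim
  obtain ⟨p, hp, hd, hle⟩ := hex k
  exact (csInf_le ⟨0, hlower k⟩ ⟨p, hp, hd, rfl⟩).trans hle
end

section
/- Let m ≥ 2 and let x ∈ ℝ^m satisfy x_1 ≥ x_2 ≥ ⋯ ≥ x_m > 0 with x_{m−1} ≥ 4·x_m. Then the infimum of D(p‖x) = Σ_i p_i·log(p_i/x_i) over all dyadic PMFs p on m symbols equals the infimum of D(q‖(x_1,…,x_{m−1})) over all dyadic PMFs q on m−1 symbols; in particular an optimal dyadic PMF assigns probability zero to the symbol with smallest x-value. -/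
/-- The KL distance splits into a negative-entropy part and a cross part. -/
lemma KL_eq_sub {α : Type*} [Fintype α] (p x : α → ℝ) (hx : ∀ i, 0 < x i) :
    KL p x = ∑ i, p i * Real.log (p i) - ∑ i, p i * Real.log (x i) := by
  rw [KL, ← Finset.sum_sub_distrib]
  refine Finset.sum_congr rfl fun i _ => ?_
  by_cases h : p i = 0
  · simp [h]
  · rw [Real.log_div h (hx i).ne']
    ring

lemma continuous_KL {α : Type*} [Fintype α] (x : α → ℝ) (hx : ∀ i, 0 < x i) :
    Continuous fun p => KL p x := by
  have h : (fun p => KL p x) =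
      fun p => ∑ i, p i * Real.log (p i) - ∑ i, p i * Real.log (x i) :=
    funext fun p => KL_eq_sub p x hx
  rw [h]
  refine Continuous.sub (continuous_finsetSum _ fun i _ => ?_) (by fun_prop)
  exact Real.continuous_mul_log.comp (continuous_apply i)

lemma isCompact_isPMF_isDyadic (α : Type*) [Fintype α] :
    IsCompact {p : α → ℝ | IsPMF p ∧ IsDyadic p} := by
  have hlim : Filter.Tendsto (fun l : ℕ => (2 : ℝ) ^ (-(l : ℤ))) Filter.atTop (nhds 0) := by
    have h := tendsto_pow_atTop_nhds_zero_of_lt_one (r := (2⁻¹ : ℝ)) (by norm_num) (by norm_num)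
    refine h.congr fun l => ?_
    simp
  have hK := isCompact_univ_pi fun _ : α => hlim.isCompact_insert_range
  have hC : IsClosed {p : α → ℝ | ∑ i, p i = 1} :=
    isClosed_eq (by fun_prop) continuous_const
  convert hK.inter_right hC using 1
  ext p
  constructor
  · rintro ⟨hp, hd⟩
    refine ⟨fun i _ => ?_, hp.2⟩
    exact (hd i).imp id fun ⟨l, hl⟩ => ⟨l, hl.symm⟩
  · rintro ⟨hd, hs⟩
    have hd' : IsDyadic p := fun i => (hd i trivial).imp id fun ⟨l, hl⟩ => ⟨l, hl.symm⟩
    refine ⟨⟨fun i => ?_, hs⟩, hd'⟩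
    rcases hd' i with h | ⟨l, h⟩ <;> rw [h]
    positivity

lemma KL_comp_swap_le {α : Type*} [Fintype α] [DecidableEq α] (p x : α → ℝ)
    (hx : ∀ i, 0 < x i) {i j : α} (hp : p i ≤ p j) (hxij : x j ≤ x i) :
    KL (p ∘ Equiv.swap i j) x ≤ KL p x := by
  by_cases hij : i = j
  · simp [hij]
  rw [KL_eq_sub _ x hx, KL_eq_sub _ x hx]
  have h1 : ∑ k, (p ∘ Equiv.swap i j) k * Real.log ((p ∘ Equiv.swap i j) k) =
      ∑ k, p k * Real.log (p k) :=
    Equiv.sum_comp (Equiv.swap i j) fun k => p k * Real.log (p k)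
  have h2 : ∑ k, ((p ∘ Equiv.swap i j) k * Real.log (x k) - p k * Real.log (x k)) =
      (p j - p i) * (Real.log (x i) - Real.log (x j)) := by
    rw [Fintype.sum_eq_add i j hij]
    · simp only [Function.comp_apply, Equiv.swap_apply_left, Equiv.swap_apply_right]
      ring
    · rintro k ⟨hi, hj⟩
      simp [Equiv.swap_apply_of_ne_of_ne hi hj]
  rw [Finset.sum_sub_distrib] at h2
  have h3 := mul_nonneg (sub_nonneg.2 hp)
    (sub_nonneg.2 (Real.log_le_log (hx j) hxij))
  linarith

lemma IsPMF.comp_equiv {α : Type*} [Fintype α] {p : α → ℝ} (hp : IsPMF p) (e : Equiv.Perm α) :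
    IsPMF (p ∘ e) :=
  ⟨fun i => hp.1 (e i), (Equiv.sum_comp e p).trans hp.2⟩

/-- In a dyadic PMF with at least two symbols and no zero entry, a smallest entry occurs twice. -/
lemma exists_ne_eq_of_forall_le {α : Type*} [Fintype α] [Nontrivial α] {p : α → ℝ}
    (hp : IsPMF p) (hd : IsDyadic p) {a : α} (hpos : 0 < p a) (hmin : ∀ i, p a ≤ p i) :
    ∃ j, j ≠ a ∧ p j = p a := by
  classical
  have h : ∀ i, ∃ l : ℕ, p i = (2 : ℝ) ^ (-(l : ℤ)) := fun i =>
    (hd i).resolve_left (hpos.trans_le (hmin i)).ne'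
  choose l hl using h
  by_contra! hne
  have hlt : ∀ i, i ≠ a → l i < l a := fun i hi => by
    have h1 := lt_of_le_of_ne (hmin i) (hne i hi).symm
    rw [hl, hl, zpow_lt_zpow_iff_right₀ one_lt_two] at h1
    omega
  have hle : ∀ i, l i ≤ l a := fun i => by
    by_cases hi : i = a
    · rw [hi]
    · exact (hlt i hi).le
  have hsum : ∑ i, 2 ^ (l a - l i) = 2 ^ l a := by
    have h1 : ∑ i, (2 : ℝ) ^ (l a - l i) = 2 ^ l a := by
      rw [← mul_one ((2 : ℝ) ^ l a), ← hp.2, Finset.mul_sum]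
      refine Finset.sum_congr rfl fun i _ => ?_
      rw [hl i, zpow_neg, zpow_natCast, pow_sub₀ _ two_ne_zero (hle i)]
    exact_mod_cast h1
  obtain ⟨b, hb⟩ := exists_ne a
  have hdvd : 2 ∣ 2 ^ l a := dvd_pow_self 2 (by have := hlt b hb; omega)
  rw [← hsum, ← Finset.add_sum_erase _ _ (Finset.mem_univ a), Nat.dvd_add_left] at hdvd
  · simp at hdvd
  · refine Finset.dvd_sum fun i hi => dvd_pow_self 2 ?_
    have := hlt i (Finset.ne_of_mem_erase hi)
    omega

/-- Merging two equal entries onto a symbol of at least four times the weight does not increase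
the KL distance. -/
lemma exists_merge {α : Type*} [Fintype α] {p x : α → ℝ} (hx : ∀ i, 0 < x i)
    (hp : IsPMF p) (hd : IsDyadic p) {a j : α} (hja : j ≠ a) (hpos : 0 < p a) (heq : p j = p a)
    (h4 : 4 * x a ≤ x j) :
    ∃ q : α → ℝ, IsPMF q ∧ IsDyadic q ∧ q a = 0 ∧ KL q x ≤ KL p x := by
  classical
  set q : α → ℝ := Function.update (Function.update p a 0) j (2 * p a) with hq
  have hqa : q a = 0 := by simp [hq, hja.symm]
  have hqj : q j = 2 * p a := by simp [hq]
  have hqo : ∀ i, i ≠ j → i ≠ a → q i = p i := fun i hi ha => by simp [hq, hi, ha]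
  have hsum : ∑ i, q i = 1 := by
    have h : ∑ i, (q i - p i) = 0 := by
      rw [Fintype.sum_eq_add j a hja, hqa, hqj, heq]
      · ring
      · rintro k ⟨h1, h2⟩
        rw [hqo k h1 h2, sub_self]
    rw [Finset.sum_sub_distrib, hp.2] at h
    linarith
  have hnn : ∀ i, 0 ≤ q i := fun i => by
    by_cases h1 : i = j
    · rw [h1, hqj]; linarith
    by_cases h2 : i = a
    · rw [h2, hqa]
    · rw [hqo i h1 h2]; exact hp.1 i
  refine ⟨q, ⟨hnn, hsum⟩, fun i => ?_, hqa, ?_⟩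
  · by_cases h1 : i = j
    · right
      obtain ⟨l, hl⟩ := (hd a).resolve_left hpos.ne'
      have hl1 : l ≠ 0 := by
        rintro rfl
        have h := Finset.single_le_sum (fun i _ => hnn i) (Finset.mem_univ j)
        rw [hsum, hqj, hl] at h
        norm_num at h
      obtain ⟨k, rfl⟩ := Nat.exists_eq_succ_of_ne_zero hl1
      refine ⟨k, ?_⟩
      rw [h1, hqj, hl, zpow_neg, zpow_neg, zpow_natCast, zpow_natCast, pow_succ]
      field_simp
    by_cases h2 : i = a
    · left; rw [h2, hqa]
    · rw [hqo i h1 h2]; exact hd i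
  · have h : ∑ i, (q i * Real.log (q i / x i) - p i * Real.log (p i / x i)) =
        p a * (Real.log (4 * x a) - Real.log (x j)) := by
      rw [Fintype.sum_eq_add j a hja, hqa, hqj, heq,
        Real.log_div (by positivity) (hx j).ne', Real.log_div hpos.ne' (hx j).ne',
        Real.log_div hpos.ne' (hx a).ne', Real.log_mul two_ne_zero hpos.ne',
        Real.log_mul four_ne_zero (hx a).ne', show (4 : ℝ) = 2 ^ 2 by norm_num, Real.log_pow]
      · push_cast; ring
      · rintro k ⟨h1, h2⟩
        rw [hqo k h1 h2, sub_self]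
    rw [Finset.sum_sub_distrib] at h
    have h5 := Real.log_le_log (by have := hx a; positivity) h4
    have h6 := mul_nonneg hpos.le (sub_nonneg.2 h5)
    unfold KL
    linarith

lemma exists_apply_eq_zero_KL_le {α : Type*} [Fintype α] [Nontrivial α] {x : α → ℝ}
    (hx : ∀ i, 0 < x i) {a : α} (h4 : ∀ i, i ≠ a → 4 * x a ≤ x i) {p : α → ℝ}
    (hp : IsPMF p) (hd : IsDyadic p) :
    ∃ q : α → ℝ, IsPMF q ∧ IsDyadic q ∧ q a = 0 ∧ KL q x ≤ KL p x := by
  classical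
  obtain ⟨i, hi⟩ := Finite.exists_min p
  have hxi : x a ≤ x i := by
    by_cases h : i = a
    · rw [h]
    · have := h4 i h
      have := hx a
      linarith
  have hle := KL_comp_swap_le p x hx (hi a) hxi
  have hp' := hp.comp_equiv (Equiv.swap i a)
  have hd' : IsDyadic (p ∘ Equiv.swap i a) := fun k => hd _
  have hmin : ∀ k, (p ∘ Equiv.swap i a) a ≤ (p ∘ Equiv.swap i a) k := fun k => by
    simpa using hi _
  rcases (hp'.1 a).eq_or_lt with h0 | hpos
  · exact ⟨_, hp', hd', h0.symm, hle⟩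
  · obtain ⟨j, hja, hj⟩ := exists_ne_eq_of_forall_le hp' hd' hpos hmin
    obtain ⟨q, hq, hqd, hqa, hqle⟩ := exists_merge hx hp' hd' hja hpos hj (h4 j hja)
    exact ⟨q, hq, hqd, hqa, hqle.trans hle⟩

lemma exists_isPMF_isDyadic_forall_KL_le {α : Type*} [Fintype α] [Nonempty α] {x : α → ℝ}
    (hx : ∀ i, 0 < x i) :
    ∃ p : α → ℝ, IsPMF p ∧ IsDyadic p ∧
      ∀ q : α → ℝ, IsPMF q → IsDyadic q → KL p x ≤ KL q x := by
  classical
  have hne : {p : α → ℝ | IsPMF p ∧ IsDyadic p}.Nonempty := by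
    obtain ⟨a⟩ := ‹Nonempty α›
    refine ⟨Pi.single a 1, ⟨fun i => ?_, by simp⟩, fun i => ?_⟩
    · by_cases h : i = a <;> simp [h]
    · by_cases h : i = a
      · exact Or.inr ⟨0, by simp [h]⟩
      · exact Or.inl (by simp [h])
  obtain ⟨p, hp, hmin⟩ :=
    (isCompact_isPMF_isDyadic α).exists_isMinOn hne (continuous_KL x hx).continuousOn
  exact ⟨p, hp.1, hp.2, fun q hq hd => hmin ⟨hq, hd⟩⟩

/-- GHC reduction step, discarding case. For a nonincreasing strictly positive
vector `x` on `m+2 ≥ 2` symbols with `x_m ≥ 4·x_{m+1}` (0-indexed last two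
entries), dropping the last entry preserves the infimum of `D(·‖x)` over dyadic
PMFs; in particular there is an optimal dyadic PMF assigning probability zero to
the symbol with smallest `x`-value. -/
theorem ghc_reduction_discard (m : ℕ) (x : Fin (m + 2) → ℝ)
    (hx : ∀ i, 0 < x i)
    (hmono : ∀ i j : Fin (m + 2), i ≤ j → x j ≤ x i)
    (hcond : x ⟨m, by omega⟩ ≥ 4 * x ⟨m + 1, by omega⟩) :
    (sInf {d : ℝ | ∃ p : Fin (m + 2) → ℝ, IsPMF p ∧ IsDyadic p ∧ d = KL p x} =
      sInf {d : ℝ | ∃ q : Fin (m + 1) → ℝ, IsPMF q ∧ IsDyadic q ∧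
        d = KL q (fun i => x (Fin.castSucc i))}) ∧
    ∃ p : Fin (m + 2) → ℝ, IsPMF p ∧ IsDyadic p ∧ p (Fin.last (m + 1)) = 0 ∧
      ∀ q : Fin (m + 2) → ℝ, IsPMF q → IsDyadic q → KL p x ≤ KL q x := by
  have h4 : ∀ i, i ≠ Fin.last (m + 1) → 4 * x (Fin.last (m + 1)) ≤ x i := fun i hi => by
    refine le_trans hcond (hmono i ⟨m, by omega⟩ ?_)
    have h := Fin.val_lt_last hi
    exact Nat.le_of_lt_succ h
  obtain ⟨p₀, hp₀, hd₀, hmin₀⟩ := exists_isPMF_isDyadic_forall_KL_le hx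
  obtain ⟨p, hp, hd, hlast, hle⟩ := exists_apply_eq_zero_KL_le hx h4 hp₀ hd₀
  have hmin : ∀ q : Fin (m + 2) → ℝ, IsPMF q → IsDyadic q → KL p x ≤ KL q x :=
    fun q hq hqd => hle.trans (hmin₀ q hq hqd)
  refine ⟨?_, p, hp, hd, hlast, hmin⟩
  have hl : IsLeast {d : ℝ | ∃ p : Fin (m + 2) → ℝ, IsPMF p ∧ IsDyadic p ∧ d = KL p x}
      (KL p x) := by
    refine ⟨⟨p, hp, hd, rfl⟩, ?_⟩
    rintro _ ⟨q, hq, hqd, rfl⟩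
    exact hmin q hq hqd
  have hr : IsLeast {d : ℝ | ∃ q : Fin (m + 1) → ℝ, IsPMF q ∧ IsDyadic q ∧
      d = KL q (fun i => x (Fin.castSucc i))} (KL p x) := by
    refine ⟨⟨fun i => p i.castSucc, ⟨fun i => hp.1 _, ?_⟩, fun i => hd _, ?_⟩, ?_⟩
    · simpa [Fin.sum_univ_castSucc, hlast] using hp.2
    · simp [KL, Fin.sum_univ_castSucc (n := m + 1), hlast]
    · rintro _ ⟨q, hq, hqd, rfl⟩
      have hs : KL (Fin.snoc q 0 : Fin (m + 2) → ℝ) x =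
          KL q (fun i => x (Fin.castSucc i)) := by
        simp [KL, Fin.sum_univ_castSucc (n := m + 1)]
      rw [← hs]
      refine hmin _ ⟨fun i => ?_, ?_⟩ fun i => ?_
      · induction i using Fin.lastCases with
        | last => simp
        | cast i => simpa using hq.1 i
      · simpa [Fin.sum_univ_castSucc (n := m + 1)] using hq.2
      · induction i using Fin.lastCases with
        | last => simp
        | cast i => simpa using hqd i
  rw [hl.csInf_eq, hr.csInf_eq]
end
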